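/- arXiv:1405.6083 — 2 statements merged into one kernel-verified Lean document; each statement's English description precedes it below -/
import Mathlib

section
/- For an odd prime ℓ, the sum over all isomorphism classes of finite abelian ℓ-groups A of 1/|Aut(A)| equals the infinite product ∏_{i=1}^∞ (1 - ℓ^{-i})^{-1}. -/
open Filter Topology
open scoped ENNReal

/-- The subgroups of `M` whose index is a power of `ℓ`. -/
abbrev PrimePowIndex (ℓ : ℕ) (M : Type*) [AddCommGroup M] : Type _ :=
  {H : AddSubgroup M // ∃ n : ℕ, H.index = ℓ ^ n}

/-- The subgroup of `M × ℤ` in Hermite normal form with data `N`, `a`, `c`. -/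
def hermiteSubgroup {M : Type*} [AddCommGroup M] (N : AddSubgroup M) (a : ℤ) (c : M ⧸ N) :
    AddSubgroup (M × ℤ) :=
  (AddSubgroup.zmultiples (c, a)).comap ((QuotientAddGroup.mk' N).prodMap (AddMonoidHom.id ℤ))

section
variable {M : Type*} [AddCommGroup M]

lemma mem_hermiteSubgroup {N : AddSubgroup M} {a : ℤ} {c : M ⧸ N} {x : M × ℤ} :
    x ∈ hermiteSubgroup N a c ↔ ∃ j : ℤ, j • c = (x.1 : M ⧸ N) ∧ j * a = x.2 := by
  simp [hermiteSubgroup, AddSubgroup.mem_zmultiples_iff, Prod.ext_iff]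

lemma index_eq_index_comap_inl_mul_index_map_snd {M' : Type*} [AddCommGroup M']
    (H : AddSubgroup (M × M')) :
    H.index = (H.comap (AddMonoidHom.inl M M')).index * (H.map (AddMonoidHom.snd M M')).index := by
  have h : (H.map (AddMonoidHom.snd M M')).comap (AddMonoidHom.snd M M') =
      (AddMonoidHom.inl M M').range ⊔ H := by
    rw [AddSubgroup.comap_map_eq, sup_comm]
    congr 1
    ext ⟨x, y⟩
    simp [AddMonoidHom.mem_range, AddSubgroup.mem_prod, eq_comm]
  rw [← AddSubgroup.index_comap_of_surjective (H.map (AddMonoidHom.snd M M'))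
    (f := AddMonoidHom.snd M M') Prod.snd_surjective, h, AddSubgroup.index_comap,
    ← AddSubgroup.relIndex_sup_right, AddSubgroup.relIndex_mul_index le_sup_right]

lemma comap_inl_hermiteSubgroup (N : AddSubgroup M) {a : ℤ} (ha : a ≠ 0) (c : M ⧸ N) :
    (hermiteSubgroup N a c).comap (AddMonoidHom.inl M ℤ) = N := by
  ext x
  simp [mem_hermiteSubgroup, ha, eq_comm (a := (0 : M ⧸ N))]

lemma map_snd_hermiteSubgroup (N : AddSubgroup M) (a : ℤ) (c : M ⧸ N) :
    (hermiteSubgroup N a c).map (AddMonoidHom.snd M ℤ) = AddSubgroup.zmultiples a := by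
  ext z
  simp only [AddSubgroup.mem_map, mem_hermiteSubgroup, AddSubgroup.mem_zmultiples_iff]
  constructor
  · rintro ⟨x, ⟨j, -, hj⟩, rfl⟩
    exact ⟨j, by simpa using hj⟩
  · rintro ⟨j, rfl⟩
    obtain ⟨m, hm⟩ := QuotientAddGroup.mk_surjective (j • c)
    exact ⟨(m, j * a), ⟨j, hm.symm, rfl⟩, by simp⟩

lemma index_hermiteSubgroup (N : AddSubgroup M) {a : ℤ} (ha : a ≠ 0) (c : M ⧸ N) :
    (hermiteSubgroup N a c).index = N.index * a.natAbs := by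
  rw [index_eq_index_comap_inl_mul_index_map_snd, comap_inl_hermiteSubgroup N ha,
    map_snd_hermiteSubgroup, Int.index_zmultiples]

lemma hermiteSubgroup_injective (N : AddSubgroup M) {a : ℤ} (ha : a ≠ 0) :
    Function.Injective (hermiteSubgroup N a) := by
  intro c c' h
  obtain ⟨m, rfl⟩ := QuotientAddGroup.mk_surjective c
  have : (m, a) ∈ hermiteSubgroup N a c' := h ▸ mem_hermiteSubgroup.2 ⟨1, by simp⟩
  obtain ⟨j, hj, hja⟩ := mem_hermiteSubgroup.1 this
  have : j = 1 := by simpa [ha] using hja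
  simpa [this] using hj.symm

lemma exists_eq_hermiteSubgroup (H : AddSubgroup (M × ℤ)) {a : ℤ}
    (ha : H.map (AddMonoidHom.snd M ℤ) = AddSubgroup.zmultiples a) :
    ∃ c, H = hermiteSubgroup (H.comap (AddMonoidHom.inl M ℤ)) a c := by
  obtain ⟨⟨m, z⟩, hm, rfl : z = a⟩ :
    a ∈ H.map (AddMonoidHom.snd M ℤ) := ha ▸ AddSubgroup.mem_zmultiples a
  refine ⟨(m : M ⧸ _), ?_⟩
  have key (j : ℤ) (x : M) : (x, j * z) ∈ H ↔
      j • (m : M ⧸ H.comap (AddMonoidHom.inl M ℤ)) = (x : M ⧸ _) := by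
    rw [← QuotientAddGroup.mk_zsmul, QuotientAddGroup.eq, AddSubgroup.mem_comap,
      ← H.add_mem_cancel_left (H.zsmul_mem hm (-j))]
    simp
  ext ⟨x, y⟩
  rw [mem_hermiteSubgroup]
  constructor
  · intro h
    have : y ∈ AddSubgroup.zmultiples z := ha ▸ ⟨_, h, rfl⟩
    obtain ⟨j, rfl⟩ := AddSubgroup.mem_zmultiples_iff.1 this
    rw [smul_eq_mul] at h
    exact ⟨j, (key j x).1 h, by simp⟩
  · rintro ⟨j, hj, hy : j * z = y⟩
    subst hy
    exact (key j x).2 hj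

/-- Subgroups of `M × ℤ` of `ℓ`-power index are classified by their Hermite normal form. -/
noncomputable def hermiteEquiv {ℓ : ℕ} (hℓ : ℓ.Prime) :
    (Σ N : PrimePowIndex ℓ M, ℕ × (M ⧸ N.1)) ≃ PrimePowIndex ℓ (M × ℤ) :=
  have h0 (d : ℕ) : ((ℓ ^ d : ℕ) : ℤ) ≠ 0 := by exact_mod_cast (pow_pos hℓ.pos d).ne'
  Equiv.ofBijective
    (fun x ↦ ⟨hermiteSubgroup x.1.1 (ℓ ^ x.2.1 : ℕ) x.2.2, by
      obtain ⟨n, hn⟩ := x.1.2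
      exact ⟨n + x.2.1, by rw [index_hermiteSubgroup _ (h0 _), hn, Int.natAbs_natCast, pow_add]⟩⟩) <|
    by
    constructor
    · rintro ⟨⟨N, hN⟩, d, c⟩ ⟨⟨N', hN'⟩, d', c'⟩ h
      have h : hermiteSubgroup N (ℓ ^ d : ℕ) c = hermiteSubgroup N' (ℓ ^ d' : ℕ) c' :=
        congrArg Subtype.val h
      obtain rfl : N = N' := by
        rw [← comap_inl_hermiteSubgroup N (h0 d) c, h, comap_inl_hermiteSubgroup N' (h0 d')]
      obtain rfl : d = d' := by
        have := congrArg AddSubgroup.index (congrArg (AddSubgroup.map (AddMonoidHom.snd M ℤ)) h)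
        rw [map_snd_hermiteSubgroup, map_snd_hermiteSubgroup, Int.index_zmultiples,
          Int.index_zmultiples, Int.natAbs_natCast, Int.natAbs_natCast] at this
        exact Nat.pow_right_injective hℓ.two_le this
      rw [hermiteSubgroup_injective N (h0 d) h]
    · rintro ⟨H, n, hn⟩
      obtain ⟨a, ha⟩ := Int.subgroup_cyclic (H.map (AddMonoidHom.snd M ℤ))
      rw [← AddSubgroup.zmultiples_eq_closure, ← Int.zmultiples_natAbs] at ha
      have hi := index_eq_index_comap_inl_mul_index_map_snd H
      rw [hn, ha, Int.index_zmultiples, Int.natAbs_natCast] at hi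
      obtain ⟨d, -, hd⟩ := (Nat.dvd_prime_pow hℓ).1 (Dvd.intro_left _ hi.symm)
      obtain ⟨e, -, he⟩ := (Nat.dvd_prime_pow hℓ).1 (Dvd.intro _ hi.symm)
      rw [hd] at ha
      obtain ⟨c, hc⟩ := exists_eq_hermiteSubgroup H ha
      exact ⟨⟨⟨_, e, he⟩, d, c⟩, Subtype.ext hc.symm⟩

lemma index_hermiteEquiv {ℓ : ℕ} (hℓ : ℓ.Prime) (x : Σ N : PrimePowIndex ℓ M, ℕ × (M ⧸ N.1)) :
    (hermiteEquiv hℓ x).1.index = x.1.1.index * ℓ ^ x.2.1 := by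
  have h0 : ((ℓ ^ x.2.1 : ℕ) : ℤ) ≠ 0 := by exact_mod_cast (pow_pos hℓ.pos _).ne'
  exact (index_hermiteSubgroup _ h0 _).trans (by rw [Int.natAbs_natCast])

lemma tsum_inv_index_prod_int {ℓ : ℕ} (hℓ : ℓ.Prime) (k : ℕ) :
    ∑' H : PrimePowIndex ℓ (M × ℤ), ((H.1.index : ℝ≥0∞) ^ (k + 1))⁻¹ =
      (∑' N : PrimePowIndex ℓ M, ((N.1.index : ℝ≥0∞) ^ k)⁻¹) * (1 - (ℓ : ℝ≥0∞)⁻¹ ^ (k + 1))⁻¹ := by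
  rw [← (hermiteEquiv hℓ).tsum_eq, ENNReal.tsum_sigma', ← ENNReal.tsum_mul_right]
  refine tsum_congr fun N ↦ ?_
  obtain ⟨n, hn⟩ := N.2
  have hl0 : (ℓ : ℝ≥0∞) ≠ 0 := by exact_mod_cast hℓ.ne_zero
  have h0 : (N.1.index : ℝ≥0∞) ≠ 0 := by rw [hn]; exact_mod_cast (pow_pos hℓ.pos n).ne'
  have : N.1.FiniteIndex := ⟨by exact_mod_cast h0⟩
  have : Fintype (M ⧸ N.1) := Fintype.ofFinite _
  rw [ENNReal.tsum_prod', ← ENNReal.tsum_geometric, ← ENNReal.tsum_mul_left]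
  refine tsum_congr fun d ↦ ?_
  simp only [index_hermiteEquiv, tsum_fintype, Finset.sum_const, Finset.card_univ, nsmul_eq_mul,
    ← Nat.card_eq_fintype_card, ← AddSubgroup.index_eq_card]
  push_cast
  have e1 : (((N.1.index : ℝ≥0∞) * ℓ ^ d) ^ (k + 1))⁻¹ =
      (N.1.index : ℝ≥0∞)⁻¹ * (((N.1.index : ℝ≥0∞) ^ k)⁻¹ * ((ℓ : ℝ≥0∞)⁻¹ ^ (k + 1)) ^ d) := by
    rw [ENNReal.inv_pow, ENNReal.mul_inv (.inl h0) (.inl (by simp)), ENNReal.inv_pow,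
      ENNReal.inv_pow]
    ring
  rw [e1, ← mul_assoc, ENNReal.mul_inv_cancel h0 (by simp), one_mul]

end

lemma tsum_inv_index_congr {ℓ : ℕ} {M M' : Type*} [AddCommGroup M] [AddCommGroup M']
    (e : M ≃+ M') (k : ℕ) :
    ∑' H : PrimePowIndex ℓ M, ((H.1.index : ℝ≥0∞) ^ k)⁻¹ =
      ∑' H : PrimePowIndex ℓ M', ((H.1.index : ℝ≥0∞) ^ k)⁻¹ := by
  have hi (H : AddSubgroup M) : (e.mapAddSubgroup H).index = H.index :=
    AddSubgroup.index_map_equiv H e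
  let E : PrimePowIndex ℓ M ≃ PrimePowIndex ℓ M' :=
    e.mapAddSubgroup.toEquiv.subtypeEquiv fun H ↦ by
      change _ ↔ ∃ n, (e.mapAddSubgroup H).index = _
      rw [hi]
  rw [← E.tsum_eq]
  refine tsum_congr fun H ↦ ?_
  change _ = (((e.mapAddSubgroup H.1).index : ℝ≥0∞) ^ k)⁻¹
  rw [hi]

/-- The zeta function of `ℤ ^ k` at `ℓ`, evaluated at `s = k`. -/
lemma tsum_inv_index_pi_int {ℓ : ℕ} (hℓ : ℓ.Prime) (k : ℕ) :
    ∑' H : PrimePowIndex ℓ (Fin k → ℤ), ((H.1.index : ℝ≥0∞) ^ k)⁻¹ =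
      ∏ i ∈ Finset.range k, (1 - (ℓ : ℝ≥0∞)⁻¹ ^ (i + 1))⁻¹ := by
  induction k with
  | zero =>
    have h : (⊤ : AddSubgroup (Fin 0 → ℤ)).index = ℓ ^ 0 := by simp
    let : Unique (PrimePowIndex ℓ (Fin 0 → ℤ)) :=
      ⟨⟨⟨⊤, 0, h⟩⟩, fun H ↦ Subtype.ext (Subsingleton.elim _ _)⟩
    simp
  | succ k ih =>
    rw [Finset.prod_range_succ, ← ih, ← tsum_inv_index_prod_int hℓ]
    exact tsum_inv_index_congr
      (AddEquiv.prodComm.trans (Fin.consLinearEquiv ℤ (fun _ : Fin (k + 1) ↦ ℤ)).toAddEquiv).symm _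

/-- The finite abelian `ℓ`-group whose cyclic factors have the exponents listed in `s`. -/
abbrev PrimaryGroup (ℓ : ℕ) (s : Multiset ℕ+) : Type :=
  ∀ i : Fin s.toList.length, ZMod (ℓ ^ (s.toList.get i : ℕ))

@[to_additive]
lemma Multiset.prod_toList_get {α β : Type*} [CommMonoid β] (s : Multiset α) (f : α → β) :
    ∏ i : Fin s.toList.length, f (s.toList.get i) = (s.map f).prod := by
  conv_rhs => rw [← s.coe_toList, Multiset.map_coe, Multiset.prod_coe]
  exact Fin.prod_univ_fun_getElem _ _

lemma Multiset.two_mul_sum_map_min (s : Multiset ℕ+) (a : ℕ+) :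
    2 * (s.map fun e : ℕ+ ↦ min (e : ℕ) a).sum = (s.map fun e : ℕ+ ↦ min (e : ℕ) (a - 1)).sum +
      (s.map fun e : ℕ+ ↦ min (e : ℕ) (a + 1)).sum + s.count a := by
  induction s using Multiset.induction_on with
  | empty => simp
  | cons b s ih =>
    have h : 2 * min (b : ℕ) a = min (b : ℕ) (a - 1) + min (b : ℕ) (a + 1) +
        if a = b then 1 else 0 := by
      have := a.pos
      have := PNat.coe_inj (n := b) (m := a)
      split_ifs <;> grind
    simp only [Multiset.map_cons, Multiset.sum_cons, Multiset.count_cons, mul_add, ih, h]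
    ring

lemma Multiset.eq_of_sum_map_min_eq {s t : Multiset ℕ+}
    (h : ∀ j : ℕ, (s.map fun e : ℕ+ ↦ min (e : ℕ) j).sum = (t.map fun e : ℕ+ ↦ min (e : ℕ) j).sum) :
    s = t := by
  ext a
  have hs := s.two_mul_sum_map_min a
  have ht := t.two_mul_sum_map_min a
  simp only [h] at hs
  omega

lemma PrimaryGroup.finite {ℓ : ℕ} (hℓ : ℓ.Prime) (s : Multiset ℕ+) : Finite (PrimaryGroup ℓ s) := by
  have : NeZero ℓ := ⟨hℓ.ne_zero⟩
  infer_instance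

lemma PrimaryGroup.exists_card_eq (ℓ : ℕ) (s : Multiset ℕ+) :
    ∃ n, Nat.card (PrimaryGroup ℓ s) = ℓ ^ n := by
  simp only [Nat.card_pi, Nat.card_zmod, Finset.prod_pow_eq_pow_sum]
  exact ⟨_, rfl⟩

lemma PrimaryGroup.card_torsion {ℓ : ℕ} (hℓ : ℓ.Prime) (s : Multiset ℕ+) (j : ℕ) :
    Nat.card {x : PrimaryGroup ℓ s // ℓ ^ j • x = 0} =
      ℓ ^ (s.map fun e : ℕ+ ↦ min (e : ℕ) j).sum := by
  have : NeZero ℓ := ⟨hℓ.ne_zero⟩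
  have key (e : ℕ) : Nat.card {x : ZMod (ℓ ^ e) // ℓ ^ j • x = 0} = ℓ ^ min e j := by
    refine (IsAddCyclic.card_nsmulAddMonoidHom_ker (G := ZMod (ℓ ^ e)) (ℓ ^ j)).trans ?_
    rw [Nat.card_zmod]
    rcases le_total e j with h | h
    · rw [min_eq_left h, Nat.gcd_eq_left (pow_dvd_pow ℓ h)]
    · rw [min_eq_right h, Nat.gcd_eq_right (pow_dvd_pow ℓ h)]
  let E : {x : PrimaryGroup ℓ s // ℓ ^ j • x = 0} ≃
      ∀ i, {y : ZMod (ℓ ^ (s.toList.get i : ℕ)) // ℓ ^ j • y = 0} :=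
    (Equiv.subtypeEquivRight fun _ ↦ funext_iff).trans <|
      Equiv.subtypePiEquivPi (p := fun i (y : ZMod (ℓ ^ (s.toList.get i : ℕ))) ↦ ℓ ^ j • y = 0)
  rw [← s.sum_toList_get fun e : ℕ+ ↦ min (e : ℕ) j, ← Finset.prod_pow_eq_pow_sum,
    Nat.card_congr E,
    Nat.card_pi]
  exact Finset.prod_congr rfl fun i _ ↦ key _

lemma PrimaryGroup.eq_of_addEquiv {ℓ : ℕ} (hℓ : ℓ.Prime) {s t : Multiset ℕ+}
    (e : PrimaryGroup ℓ s ≃+ PrimaryGroup ℓ t) :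
    s = t := by
  refine Multiset.eq_of_sum_map_min_eq fun j ↦ Nat.pow_right_injective hℓ.two_le ?_
  simp only [← PrimaryGroup.card_torsion hℓ]
  refine Nat.card_congr (e.toEquiv.subtypeEquiv fun x ↦ ?_)
  change _ ↔ _ • e x = 0
  rw [← map_nsmul, map_eq_zero_iff e e.injective]

lemma Fintype.exists_equiv_of_map_univ_val_eq {ι κ α : Type*} [Fintype ι] [Fintype κ]
    {f : ι → α} {g : κ → α} (h : Finset.univ.val.map f = Finset.univ.val.map g) :
    ∃ σ : ι ≃ κ, ∀ i, g (σ i) = f i := by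
  classical
  have hc (c : α) : Nonempty ({i // f i = c} ≃ {k // g k = c}) := by
    rw [← Fintype.card_eq, Fintype.card_subtype, Fintype.card_subtype]
    have := congrArg (Multiset.count c) h
    simpa [Multiset.count_map, Finset.card_def, eq_comm] using this
  exact ⟨Equiv.ofFiberEquiv fun c ↦ (hc c).some, fun i ↦ Equiv.ofFiberEquiv_map _ i⟩

lemma PrimaryGroup.nonempty_pi_addEquiv (ℓ : ℕ) {ι : Type*} [Fintype ι] (e : ι → ℕ+) :
    Nonempty ((∀ i, ZMod (ℓ ^ (e i : ℕ))) ≃+ PrimaryGroup ℓ (Finset.univ.val.map e)) := by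
  have h : Finset.univ.val.map e = Finset.univ.val.map (Finset.univ.val.map e).toList.get := by
    rw [Fin.univ_val_map, List.ofFn_get, Multiset.coe_toList]
  obtain ⟨σ, hσ⟩ := Fintype.exists_equiv_of_map_univ_val_eq h
  exact ⟨(AddEquiv.piCongrRight fun i ↦
      (ZMod.ringEquivCongr (by rw [hσ])).toAddEquiv).trans
    (LinearEquiv.piCongrLeft ℤ (fun j ↦ ZMod (ℓ ^ ((Finset.univ.val.map e).toList.get j : ℕ)))
      σ).toAddEquiv⟩

lemma PrimaryGroup.exists_addEquiv {ℓ : ℕ} (hℓ : ℓ.Prime) {G : Type*} [AddCommGroup G] {n : ℕ}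
    (hG : Nat.card G = ℓ ^ n) : ∃ s, Nonempty (G ≃+ PrimaryGroup ℓ s) := by
  classical
  have : Finite G := Nat.finite_of_card_ne_zero (hG ▸ (pow_pos hℓ.pos n).ne')
  obtain ⟨ι, _, m, hm, ⟨e⟩⟩ := AddCommGroup.equiv_directSum_zmod_of_finite' G
  let e' : G ≃+ ∀ i, ZMod (m i) := e.trans (DirectSum.addEquivProd _)
  have h (i : ι) : ∃ a : ℕ+, m i = ℓ ^ (a : ℕ) := by
    have hd : m i ∣ ℓ ^ n := by
      rw [← hG, Nat.card_congr e'.toEquiv, Nat.card_pi]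
      simpa using Finset.dvd_prod_of_mem m (Finset.mem_univ i)
    obtain ⟨a, -, ha⟩ := (Nat.dvd_prime_pow hℓ).1 hd
    have : 0 < a := Nat.pos_of_ne_zero fun h0 ↦ by have := hm i; simp [ha, h0] at this
    exact ⟨⟨a, this⟩, ha⟩
  choose a ha using h
  obtain rfl : m = fun i ↦ ℓ ^ (a i : ℕ) := funext ha
  exact ⟨_, (PrimaryGroup.nonempty_pi_addEquiv ℓ a).map e'.trans⟩

section
variable {F A : Type*} [AddCommGroup F] [AddCommGroup A]

/-- A surjection onto `A` is the same as a subgroup with an identification of its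
quotient with `A`. -/
noncomputable def surjectiveHomEquiv {ℓ n : ℕ} (hA : Nat.card A = ℓ ^ n) :
    (Σ H : PrimePowIndex ℓ F, (F ⧸ H.1 ≃+ A)) ≃ {f : F →+ A // Function.Surjective f} :=
  Equiv.ofBijective
    (fun x ↦ ⟨x.2.toAddMonoidHom.comp (QuotientAddGroup.mk' x.1.1),
      x.2.surjective.comp (QuotientAddGroup.mk'_surjective _)⟩) <| by
    constructor
    · rintro ⟨⟨H, hH⟩, e⟩ ⟨⟨H', hH'⟩, e'⟩ h
      have h : e.toAddMonoidHom.comp (QuotientAddGroup.mk' H) =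
        e'.toAddMonoidHom.comp (QuotientAddGroup.mk' H') := congrArg Subtype.val h
      obtain rfl : H = H' := by
        ext x
        have := DFunLike.congr_fun h x
        rw [← QuotientAddGroup.eq_zero_iff, ← map_eq_zero_iff e e.injective,
          ← QuotientAddGroup.eq_zero_iff, ← map_eq_zero_iff e' e'.injective]
        exact Eq.congr_left this
      obtain rfl : e = e' := by
        ext x
        obtain ⟨x, rfl⟩ := QuotientAddGroup.mk_surjective x
        exact DFunLike.congr_fun h x
      rfl
    · rintro ⟨f, hf⟩
      let e := QuotientAddGroup.quotientKerEquivOfSurjective f hf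
      refine ⟨⟨⟨f.ker, n, ?_⟩, e⟩, rfl⟩
      rw [AddSubgroup.index_eq_card, Nat.card_congr e.toEquiv, hA]

lemma card_addEquiv_eq_card_addAut (e : F ≃+ A) : Nat.card (F ≃+ A) = Nat.card (AddAut A) :=
  Nat.card_congr
    { toFun := fun f ↦ e.symm.trans f
      invFun := fun g ↦ e.trans g
      left_inv := fun f ↦ by ext; simp
      right_inv := fun g ↦ by ext; simp }

open Classical in
lemma card_surjective_eq_tsum [Finite A] [Finite (F →+ A)] {ℓ n : ℕ} (hA : Nat.card A = ℓ ^ n) :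
    (Nat.card {f : F →+ A // Function.Surjective f} : ℝ≥0∞) =
      ∑' H : PrimePowIndex ℓ F, if Nonempty (F ⧸ H.1 ≃+ A) then (Nat.card (AddAut A) : ℝ≥0∞)
        else 0 := by
  have hfin := Finite.of_equiv _ (surjectiveHomEquiv (F := F) hA).symm
  have : ∀ H : PrimePowIndex ℓ F, Finite (F ⧸ H.1 ≃+ A) := fun H ↦
    Finite.of_injective (fun e ↦ (⟨H, e⟩ : Σ H : PrimePowIndex ℓ F, (F ⧸ H.1 ≃+ A)))
      fun _ _ h ↦ by simpa using h
  have h1 {α : Type _} [Finite α] : (Nat.card α : ℝ≥0∞) = ∑' _ : α, 1 := by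
    have := Fintype.ofFinite α
    simp [tsum_fintype]
  rw [← Nat.card_congr (surjectiveHomEquiv (F := F) hA), h1, ENNReal.tsum_sigma']
  refine tsum_congr fun H ↦ ?_
  split_ifs with h
  · obtain ⟨e⟩ := h
    rw [← card_addEquiv_eq_card_addAut e, h1]
  · have := not_nonempty_iff.1 h
    simp

lemma card_pi_int_hom (A : Type*) [AddCommGroup A] (k : ℕ) :
    Nat.card ((Fin k → ℤ) →+ A) = Nat.card A ^ k := by
  rw [Nat.card_congr ((addMonoidHomLequivInt (A := Fin k → ℤ) (B := A) ℤ).toEquiv.trans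
    ((Pi.basisFun ℤ (Fin k)).constr ℤ).symm.toEquiv), Nat.card_fun, Nat.card_fin]

instance [Finite A] (k : ℕ) : Finite ((Fin k → ℤ) →+ A) :=
  Finite.of_equiv _ ((addMonoidHomLequivInt (A := Fin k → ℤ) (B := A) ℤ).toEquiv.trans
    ((Pi.basisFun ℤ (Fin k)).constr ℤ).symm.toEquiv).symm

lemma card_pow_le_card_surjective_add_sum [Finite A]
    [Fintype {B : AddSubgroup A // B ≠ ⊤}] (k : ℕ) :
    Nat.card A ^ k ≤ Nat.card {f : (Fin k → ℤ) →+ A // Function.Surjective f} +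
      ∑ B : {B : AddSubgroup A // B ≠ ⊤}, Nat.card B ^ k := by
  let φ : {f : (Fin k → ℤ) →+ A // Function.Surjective f} ⊕
      (Σ B : {B : AddSubgroup A // B ≠ ⊤}, ((Fin k → ℤ) →+ B.1)) → ((Fin k → ℤ) →+ A) :=
    Sum.elim Subtype.val fun x ↦ x.1.1.subtype.comp x.2
  have hφ : Function.Surjective φ := fun f ↦ by
    by_cases hf : Function.Surjective f
    · exact ⟨.inl ⟨f, hf⟩, rfl⟩
    · exact ⟨.inr ⟨⟨f.range, fun h ↦ hf (AddMonoidHom.range_eq_top.1 h)⟩, f.rangeRestrict⟩, rfl⟩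
  have := Nat.card_le_card_of_surjective φ hφ
  simpa only [Nat.card_sum, Nat.card_sigma, card_pi_int_hom] using this

end

lemma card_addAut_cast_ne_zero (A : Type*) [AddCommGroup A] [Finite A] :
    (Nat.card (AddAut A) : ℝ≥0∞) ≠ 0 := by
  have : Finite (AddAut A) := DFunLike.finite _
  exact_mod_cast Nat.card_pos.ne'

lemma tsum_card_surjective_div {ℓ : ℕ} (hℓ : ℓ.Prime) (k : ℕ) :
    ∑' s : Multiset ℕ+, (Nat.card (AddAut (PrimaryGroup ℓ s)) : ℝ≥0∞)⁻¹ *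
        (Nat.card {f : (Fin k → ℤ) →+ PrimaryGroup ℓ s // Function.Surjective f} /
          (Nat.card (PrimaryGroup ℓ s) : ℝ≥0∞) ^ k) =
      ∏ i ∈ Finset.range k, (1 - (ℓ : ℝ≥0∞)⁻¹ ^ (i + 1))⁻¹ := by
  classical
  have hfin (s : Multiset ℕ+) := PrimaryGroup.finite hℓ s
  have hterm (s : Multiset ℕ+) : (Nat.card (AddAut (PrimaryGroup ℓ s)) : ℝ≥0∞)⁻¹ *
        (Nat.card {f : (Fin k → ℤ) →+ PrimaryGroup ℓ s // Function.Surjective f} /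
          (Nat.card (PrimaryGroup ℓ s) : ℝ≥0∞) ^ k) =
      ∑' H : PrimePowIndex ℓ (Fin k → ℤ),
        if Nonempty (((Fin k → ℤ) ⧸ H.1) ≃+ PrimaryGroup ℓ s) then
          ((H.1.index : ℝ≥0∞) ^ k)⁻¹ else 0 := by
    obtain ⟨n, hn⟩ := PrimaryGroup.exists_card_eq ℓ s
    have h0 := card_addAut_cast_ne_zero (PrimaryGroup ℓ s)
    rw [card_surjective_eq_tsum hn, div_eq_mul_inv, ← mul_assoc, ← ENNReal.tsum_mul_left,
      ← ENNReal.tsum_mul_right]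
    refine tsum_congr fun H ↦ ?_
    split_ifs with h
    · rw [ENNReal.inv_mul_cancel h0 (by simp), one_mul, AddSubgroup.index_eq_card,
        Nat.card_congr h.some.toEquiv]
    · simp
  simp only [hterm]
  rw [ENNReal.tsum_comm, ← tsum_inv_index_pi_int hℓ]
  refine tsum_congr fun H ↦ ?_
  obtain ⟨n, hn⟩ := H.2
  rw [AddSubgroup.index_eq_card] at hn
  obtain ⟨s, ⟨e⟩⟩ := PrimaryGroup.exists_addEquiv hℓ hn
  rw [tsum_eq_single s, if_pos ⟨e⟩]
  intro t ht
  exact if_neg fun ⟨e'⟩ ↦ ht (PrimaryGroup.eq_of_addEquiv hℓ (e'.symm.trans e))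

lemma card_surjective_div_le_one (A : Type*) [AddCommGroup A] [Finite A] (k : ℕ) :
    (Nat.card {f : (Fin k → ℤ) →+ A // Function.Surjective f} / (Nat.card A : ℝ≥0∞) ^ k) ≤ 1 := by
  refine ENNReal.div_le_of_le_mul ?_
  rw [one_mul]
  exact_mod_cast (Finite.card_subtype_le _).trans (card_pi_int_hom A k).le

lemma exists_tendsto_one_le_card_surjective_div_add (A : Type*) [AddCommGroup A] [Finite A] :
    ∃ ε : ℕ → ℝ≥0∞, Tendsto ε atTop (𝓝 0) ∧ ∀ k,
      1 ≤ Nat.card {f : (Fin k → ℤ) →+ A // Function.Surjective f} / (Nat.card A : ℝ≥0∞) ^ k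
        + ε k := by
  have := Fintype.ofFinite {B : AddSubgroup A // B ≠ ⊤}
  have h0 : (Nat.card A : ℝ≥0∞) ≠ 0 := by exact_mod_cast Nat.card_pos.ne'
  refine ⟨fun k ↦ ∑ B : {B : AddSubgroup A // B ≠ ⊤}, ((Nat.card B : ℝ≥0∞) / Nat.card A) ^ k,
    ?_, fun k ↦ ?_⟩
  · rw [← Finset.sum_const_zero (s := (Finset.univ : Finset {B : AddSubgroup A // B ≠ ⊤}))]
    refine tendsto_finsetSum _ fun B _ ↦ ENNReal.tendsto_pow_atTop_nhds_zero_of_lt_one ?_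
    refine ENNReal.div_lt_of_lt_mul ?_
    rw [one_mul]
    have : Nat.card B.1 ≠ Nat.card A := fun h ↦ B.2 (AddSubgroup.card_eq_iff_eq_top _ |>.1 h)
    exact_mod_cast (AddSubgroup.card_le_card_addGroup B.1).lt_of_ne this
  · have h := card_pow_le_card_surjective_add_sum (A := A) k
    have h' : (Nat.card A : ℝ≥0∞) ^ k ≤
        Nat.card {f : (Fin k → ℤ) →+ A // Function.Surjective f} +
          ∑ B : {B : AddSubgroup A // B ≠ ⊤}, (Nat.card B : ℝ≥0∞) ^ k := by exact_mod_cast h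
    have := ENNReal.div_le_div_right h' ((Nat.card A : ℝ≥0∞) ^ k)
    rw [ENNReal.div_self (pow_ne_zero _ h0) (by simp), ENNReal.add_div,
      div_eq_mul_inv (Finset.sum _ _), Finset.sum_mul] at this
    refine this.trans_eq (congrArg _ (Finset.sum_congr rfl fun B _ ↦ ?_))
    rw [div_eq_mul_inv, mul_pow, ENNReal.inv_pow]

lemma tsum_inv_card_addAut {ℓ : ℕ} (hℓ : ℓ.Prime) {L : ℝ≥0∞}
    (hL : Tendsto (fun k ↦ ∏ i ∈ Finset.range k, (1 - (ℓ : ℝ≥0∞)⁻¹ ^ (i + 1))⁻¹) atTop (𝓝 L)) :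
    ∑' s : Multiset ℕ+, (Nat.card (AddAut (PrimaryGroup ℓ s)) : ℝ≥0∞)⁻¹ = L := by
  have hfin (s : Multiset ℕ+) := PrimaryGroup.finite hℓ s
  apply le_antisymm
  · rw [ENNReal.tsum_eq_iSup_sum]
    refine iSup_le fun T ↦ ?_
    choose ε hε hle using fun s : Multiset ℕ+ ↦
      exists_tendsto_one_le_card_surjective_div_add (PrimaryGroup ℓ s)
    have hlim : Tendsto (fun k ↦ ∏ i ∈ Finset.range k, (1 - (ℓ : ℝ≥0∞)⁻¹ ^ (i + 1))⁻¹ +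
        ∑ s ∈ T, (Nat.card (AddAut (PrimaryGroup ℓ s)) : ℝ≥0∞)⁻¹ * ε s k) atTop
        (𝓝 (L + ∑ s ∈ T, (Nat.card (AddAut (PrimaryGroup ℓ s)) : ℝ≥0∞)⁻¹ * 0)) := by
      refine hL.add (tendsto_finsetSum _ fun s _ ↦ ENNReal.Tendsto.const_mul (hε s) (.inr ?_))
      exact ENNReal.inv_ne_top.2 (card_addAut_cast_ne_zero _)
    simp only [mul_zero, Finset.sum_const_zero, add_zero] at hlim
    refine ge_of_tendsto' hlim fun k ↦ ?_
    rw [← tsum_card_surjective_div hℓ k]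
    refine le_trans ?_ (add_le_add_left (ENNReal.sum_le_tsum T) _)
    rw [← Finset.sum_add_distrib]
    refine Finset.sum_le_sum fun s _ ↦ ?_
    rw [← mul_add]
    exact le_mul_of_one_le_right' (hle s k)
  · refine le_of_tendsto' hL fun k ↦ ?_
    rw [← tsum_card_surjective_div hℓ k]
    exact ENNReal.tsum_le_tsum fun s ↦ mul_le_of_le_one_right' (card_surjective_div_le_one _ k)

lemma multipliable_inv_one_sub_pow {q : ℝ} (h0 : 0 ≤ q) (h1 : q < 1) :
    Multipliable fun i : ℕ ↦ (1 - q ^ (i + 1))⁻¹ := by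
  have hq (i : ℕ) : q ^ (i + 1) ≤ q := pow_le_of_le_one h0 h1.le i.succ_ne_zero
  have hs : Summable fun i : ℕ ↦ q ^ (i + 1) / (1 - q ^ (i + 1)) := by
    refine Summable.of_nonneg_of_le (fun i ↦ ?_) (fun i ↦ ?_)
      (((summable_nat_add_iff 1).2 (summable_geometric_of_lt_one h0 h1)).mul_right (1 - q)⁻¹)
    · exact div_nonneg (pow_nonneg h0 _) (by linarith [hq i])
    · rw [div_eq_mul_inv]
      have := hq i
      gcongr
  convert Real.multipliable_one_add_of_summable hs using 2 with i
  have : 1 - q ^ (i + 1) ≠ 0 := by linarith [hq i]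
  field_simp
  ring

/-- Hall's identity: the sum of `1/|Aut A|` over isomorphism classes of finite
abelian `ℓ`-groups equals `∏_{i=1}^∞ (1 - ℓ^{-i})^{-1}`.  Isomorphism classes of
finite abelian `ℓ`-groups are indexed by multisets of positive integers (the
exponents of the cyclic factors). -/
theorem hall_identity (ℓ : ℕ) (hℓ : ℓ.Prime) (hodd : Odd ℓ) :
    ∑' s : Multiset ℕ+,
      ((Nat.card (AddAut (∀ i : Fin s.toList.length, ZMod (ℓ ^ (s.toList.get i : ℕ)))) : ℝ))⁻¹
    = ∏' i : ℕ, (1 - ((ℓ : ℝ))⁻¹ ^ (i + 1))⁻¹ := by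
  have hl : (1 : ℝ) < ℓ := by exact_mod_cast hℓ.one_lt
  have h0 : 0 ≤ (ℓ : ℝ)⁻¹ := by positivity
  have h1 : (ℓ : ℝ)⁻¹ < 1 := inv_lt_one_of_one_lt₀ hl
  have hpos (i : ℕ) : 0 < 1 - (ℓ : ℝ)⁻¹ ^ (i + 1) := sub_pos.2 (pow_lt_one₀ h0 h1 i.succ_ne_zero)
  have hfactor (i : ℕ) : (1 - (ℓ : ℝ≥0∞)⁻¹ ^ (i + 1))⁻¹ =
      ENNReal.ofReal (1 - (ℓ : ℝ)⁻¹ ^ (i + 1))⁻¹ := by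
    rw [ENNReal.ofReal_inv_of_pos (hpos i), ENNReal.ofReal_sub _ (pow_nonneg h0 _),
      ENNReal.ofReal_pow h0, ENNReal.ofReal_inv_of_pos (by positivity), ENNReal.ofReal_natCast,
      ENNReal.ofReal_one]
  have hprod := (multipliable_inv_one_sub_pow h0 h1).hasProd.tendsto_prod_nat
  have key := tsum_inv_card_addAut hℓ
    (L := ENNReal.ofReal (∏' i : ℕ, (1 - (ℓ : ℝ)⁻¹ ^ (i + 1))⁻¹)) <| by
      simp only [hfactor, ← ENNReal.ofReal_prod_of_nonneg fun i _ ↦ (inv_pos.2 (hpos i)).le]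
      exact ENNReal.tendsto_ofReal hprod
  have hnonneg : 0 ≤ ∏' i : ℕ, (1 - (ℓ : ℝ)⁻¹ ^ (i + 1))⁻¹ :=
    ge_of_tendsto' hprod fun k ↦ Finset.prod_nonneg fun i _ ↦ (inv_pos.2 (hpos i)).le
  rw [← ENNReal.toReal_ofReal hnonneg, ← key, ENNReal.tsum_toReal_eq]
  · simp only [ENNReal.toReal_inv, ENNReal.toReal_natCast]
  · intro s
    have := PrimaryGroup.finite hℓ s
    exact ENNReal.inv_ne_top.2 (card_addAut_cast_ne_zero _)
end

section
/- Let ℓ be a prime, A a finite abelian ℓ-group of ℓ-rank r, let s be the ℓ²-rank of A, and for i ≥ 0 let A_{⊕i} = A ⊕ (Z/ℓ)^i. Then for 0 ≤ k ≤ m, the number of subgroups of A_{⊕m} isomorphic to A_{⊕k} is sub(A_{⊕k}, A_{⊕m}) = ℓ^{(r+k)(m−k)} (ℓ^{-1})_{r−s+m} / ((ℓ^{-1})_{r−s+k} (ℓ^{-1})_{m−k}). -/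
/-- `(ℓ^{-1})_m = ∏_{j=1}^m (1 − ℓ^{-j})`. -/
noncomputable def lPoch (ℓ : ℕ) (m : ℕ) : ℝ := ∏ j ∈ Finset.range m, (1 - ((ℓ : ℝ))⁻¹ ^ (j + 1))

section Injections

variable {G G₁ H H₁ : Type*} [AddCommGroup G] [AddCommGroup G₁] [AddCommGroup H] [AddCommGroup H₁]

/-- The number of injective homomorphisms `G →+ H`. -/
noncomputable def cardInj (G H : Type*) [AddCommGroup G] [AddCommGroup H] : ℕ :=
  Nat.card {f : G →+ H // Function.Injective f}

/-- The number of elements of `G` killed by `ℓ`. -/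
noncomputable def cardTorsion (ℓ : ℕ) (G : Type*) [AddCommGroup G] : ℕ :=
  Nat.card {a : G // ℓ • a = 0}

theorem cardInj_congr (e : G ≃+ G₁) (e' : H ≃+ H₁) : cardInj G H = cardInj G₁ H₁ := by
  refine Nat.card_congr
    { toFun := fun f => ⟨e'.toAddMonoidHom.comp (f.1.comp e.symm.toAddMonoidHom),
        e'.injective.comp (f.2.comp e.symm.injective)⟩
      invFun := fun f => ⟨e'.symm.toAddMonoidHom.comp (f.1.comp e.toAddMonoidHom),
        e'.symm.injective.comp (f.2.comp e.injective)⟩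
      left_inv := fun f => by ext; simp
      right_inv := fun f => by ext; simp }

theorem cardTorsion_congr (ℓ : ℕ) (e : G ≃+ G₁) : cardTorsion ℓ G = cardTorsion ℓ G₁ :=
  Nat.card_congr (e.toEquiv.subtypeEquiv fun a => by
    rw [AddEquiv.toEquiv_eq_coe, AddEquiv.coe_toEquiv, ← map_nsmul, EmbeddingLike.map_eq_zero_iff])

theorem cardTorsion_prod (ℓ : ℕ) (G H : Type*) [AddCommGroup G] [AddCommGroup H] :
    cardTorsion ℓ (G × H) = cardTorsion ℓ G * cardTorsion ℓ H := by
  rw [cardTorsion, cardTorsion, cardTorsion, ← Nat.card_prod]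
  refine Nat.card_congr ((Equiv.subtypeEquivRight fun a => ?_).trans
    (Equiv.subtypeProdEquivProd (p := fun a : G => ℓ • a = 0) (q := fun a : H => ℓ • a = 0)))
  simp [Prod.ext_iff]

theorem cardTorsion_pi (ℓ n : ℕ) : cardTorsion ℓ (Fin n → ZMod ℓ) = ℓ ^ n := by
  have h : ∀ a : Fin n → ZMod ℓ, ℓ • a = 0 := fun a => by
    ext i
    simp
  rw [cardTorsion, Nat.card_congr (Equiv.subtypeUnivEquiv h), Nat.card_fun]
  simp

theorem cardInj_self_pos (G : Type*) [AddCommGroup G] [Finite G] : 0 < cardInj G G := by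
  have : Finite (G →+ G) := DFunLike.finite _
  have : Nonempty {f : G →+ G // Function.Injective f} :=
    ⟨⟨AddMonoidHom.id G, Function.injective_id⟩⟩
  exact Nat.card_pos

/-- Injective homomorphisms are embeddings onto a subgroup, up to automorphisms of the source. -/
theorem cardInj_eq_card_subgroups_mul [Finite G] :
    cardInj G H = Nat.card {K : AddSubgroup H // Nonempty (K ≃+ G)} * cardInj G G := by
  rw [cardInj, cardInj, ← Nat.card_prod]
  let φ (K : {K : AddSubgroup H // Nonempty (K ≃+ G)}) : K.1 ≃+ G := K.2.some
  refine Nat.card_congr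
    { toFun := fun f =>
        ⟨⟨f.1.range, ⟨(AddMonoidHom.ofInjective f.2).symm⟩⟩,
          ⟨(φ ⟨f.1.range, ⟨(AddMonoidHom.ofInjective f.2).symm⟩⟩).toAddMonoidHom.comp
            f.1.rangeRestrict, (AddEquiv.injective _).comp
              ((AddMonoidHom.rangeRestrict_injective_iff).2 f.2)⟩⟩
      invFun := fun p => ⟨p.1.1.subtype.comp ((φ p.1).symm.toAddMonoidHom.comp p.2.1),
        Subtype.val_injective.comp ((φ p.1).symm.injective.comp p.2.2)⟩
      left_inv := fun f => by ext x; simp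
      right_inv := ?_ }
  rintro ⟨⟨K, hK⟩, g, hg⟩
  have hsurj : Function.Surjective g := Finite.surjective_of_injective hg
  have hrange : (K.subtype.comp ((φ ⟨K, hK⟩).symm.toAddMonoidHom.comp g)).range = K := by
    ext x
    constructor
    · rintro ⟨y, rfl⟩
      simp
    · intro hx
      obtain ⟨y, hy⟩ := hsurj (φ ⟨K, hK⟩ ⟨x, hx⟩)
      exact ⟨y, by simp [hy]⟩
  have key : ∀ (K' : AddSubgroup H) (hK' : Nonempty (K' ≃+ G)) (g' : G →+ G)
      (hg' : Function.Injective g'), K' = K →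
      (∀ x, ((φ ⟨K', hK'⟩).symm (g' x) : H) = (φ ⟨K, hK⟩).symm (g x)) →
      ((⟨⟨K', hK'⟩, ⟨g', hg'⟩⟩ : {K : AddSubgroup H // Nonempty (K ≃+ G)} ×
        {f : G →+ G // Function.Injective f})) = ⟨⟨K, hK⟩, ⟨g, hg⟩⟩ := by
    rintro K' hK' g' hg' rfl h
    have : g' = g := by
      ext x
      exact (φ ⟨K', hK'⟩).symm.injective (Subtype.ext (h x))
    subst this
    rfl
  exact key _ _ _ _ hrange fun x => congrArg Subtype.val (AddEquiv.symm_apply_apply _ _)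

theorem injective_of_injective_on_torsion {ℓ : ℕ} (hG : ∀ a : G, ∃ n : ℕ, (ℓ ^ n) • a = 0)
    (f : G →+ H) (hf : ∀ a, ℓ • a = 0 → f a = 0 → a = 0) : Function.Injective f := by
  rw [injective_iff_map_eq_zero]
  intro a ha
  obtain ⟨n, hn⟩ := hG a
  induction n with
  | zero => simpa using hn
  | succ n ih =>
    refine ih (hf _ ?_ ?_)
    · rw [← mul_smul, ← pow_succ', hn]
    · rw [map_nsmul, ha, smul_zero]

theorem card_torsion_not_mem_range {ℓ : ℕ} [Finite G] [Finite H] (f : G →+ H)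
    (hf : Function.Injective f) :
    Nat.card {x : H // ℓ • x = 0 ∧ x ∉ f.range} = cardTorsion ℓ H - cardTorsion ℓ G := by
  have h1 : cardTorsion ℓ G = Nat.card {x : H // ℓ • x = 0 ∧ x ∈ f.range} := by
    refine Nat.card_congr (Equiv.ofBijective
      (fun a => ⟨f a.1, by rw [← map_nsmul, a.2, map_zero], ⟨a.1, rfl⟩⟩) ⟨?_, ?_⟩)
    · intro a b hab
      exact Subtype.ext (hf (congrArg Subtype.val hab))
    · rintro ⟨_, hx, a, rfl⟩
      refine ⟨⟨a, hf ?_⟩, rfl⟩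
      rw [map_nsmul, hx, map_zero]
  have h2 : cardTorsion ℓ H = Nat.card {x : H // ℓ • x = 0 ∧ x ∈ f.range} +
      Nat.card {x : H // ℓ • x = 0 ∧ x ∉ f.range} := by
    classical
    rw [cardTorsion, ← Nat.card_sum]
    refine Nat.card_congr ((Equiv.sumCompl fun x : {x : H // ℓ • x = 0} => x.1 ∈ f.range).symm.trans
      (Equiv.sumCongr (Equiv.subtypeSubtypeEquivSubtypeInter _ _)
        (Equiv.subtypeSubtypeEquivSubtypeInter _ (fun x => x ∉ f.range))))
  omega

/-- The homomorphism from `ZMod ℓ` sending `1` to an element killed by `ℓ`. -/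
def zmodHomOfTorsion {ℓ : ℕ} (x : H) (hx : ℓ • x = 0) : ZMod ℓ →+ H :=
  ZMod.lift ℓ ⟨zmultiplesHom H x, by simpa using hx⟩

theorem zmodHomOfTorsion_intCast {ℓ : ℕ} (x : H) (hx : ℓ • x = 0) (n : ℤ) :
    zmodHomOfTorsion x hx (n : ZMod ℓ) = n • x := by
  simp [zmodHomOfTorsion]

theorem zmodHomOfTorsion_one {ℓ : ℕ} (x : H) (hx : ℓ • x = 0) :
    zmodHomOfTorsion x hx (1 : ZMod ℓ) = x := by
  simpa using zmodHomOfTorsion_intCast x hx 1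

theorem coprod_zmodHomOfTorsion_injective {ℓ : ℕ} (hℓ : ℓ.Prime) (f : G →+ H)
    (hf : Function.Injective f) (x : H) (hx : ℓ • x = 0) (hxf : x ∉ f.range) :
    Function.Injective (f.coprod (zmodHomOfTorsion x hx)) := by
  rw [injective_iff_map_eq_zero]
  rintro ⟨g, c⟩ h
  obtain ⟨n, rfl⟩ := ZMod.intCast_surjective c
  rw [AddMonoidHom.coprod_apply, zmodHomOfTorsion_intCast] at h
  by_cases hn : (ℓ : ℤ) ∣ n
  · have hn0 : ((n : ℤ) : ZMod ℓ) = 0 := (ZMod.intCast_zmod_eq_zero_iff_dvd n ℓ).2 hn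
    obtain ⟨k, rfl⟩ := hn
    have : ((ℓ : ℤ) * k) • x = 0 := by
      rw [mul_comm, mul_smul, natCast_zsmul, hx, smul_zero]
    rw [this, add_zero] at h
    rw [hn0, (injective_iff_map_eq_zero f).1 hf g h]
    rfl
  · exfalso
    have hcop : IsCoprime (ℓ : ℤ) n :=
      ((Nat.prime_iff_prime_int.1 hℓ).coprime_iff_not_dvd).2 hn
    obtain ⟨a, b, hab⟩ := hcop
    apply hxf
    refine ⟨-(b • g), ?_⟩
    have h1 : n • x = - f g := by rw [eq_neg_iff_add_eq_zero, add_comm, h]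
    have h2 : x = (a * (ℓ : ℤ) + b * n) • x := by rw [hab, one_smul]
    rw [add_smul, mul_smul, mul_smul, natCast_zsmul, hx, smul_zero, zero_add, h1] at h2
    rw [map_neg, map_zsmul]
    rw [h2, smul_neg]

theorem cardInj_prod_zmod {ℓ : ℕ} (hℓ : ℓ.Prime) [Finite G] [Finite H] :
    cardInj (G × ZMod ℓ) H = cardInj G H * (cardTorsion ℓ H - cardTorsion ℓ G) := by
  have : Finite (G →+ H) := DFunLike.finite _
  have e : {f : G × ZMod ℓ →+ H // Function.Injective f} ≃
      (Σ f : {f : G →+ H // Function.Injective f}, {x : H // ℓ • x = 0 ∧ x ∉ f.1.range}) :=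
    { toFun := fun f => ⟨⟨f.1.comp (AddMonoidHom.inl G (ZMod ℓ)),
          f.2.comp fun a b h => congrArg Prod.fst h⟩,
        ⟨f.1 (0, 1), by 
            rw [← map_nsmul, show ℓ • ((0, 1) : G × ZMod ℓ) = 0 by simp [Prod.ext_iff], map_zero], by
          rintro ⟨g, hg⟩
          have : Fact (1 < ℓ) := ⟨hℓ.one_lt⟩
          exact zero_ne_one (congrArg Prod.snd (f.2 hg))⟩⟩
      invFun := fun p => ⟨p.1.1.coprod (zmodHomOfTorsion p.2.1 p.2.2.1),
        coprod_zmodHomOfTorsion_injective hℓ p.1.1 p.1.2 p.2.1 p.2.2.1 p.2.2.2⟩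
      left_inv := fun f => by
        apply Subtype.ext
        refine AddMonoidHom.ext fun ⟨g, c⟩ => ?_
        obtain ⟨n, rfl⟩ := ZMod.intCast_surjective c
        rw [AddMonoidHom.coprod_apply, zmodHomOfTorsion_intCast, ← map_zsmul,
          AddMonoidHom.comp_apply, ← map_add]
        simp
      right_inv := fun ⟨⟨f, hf⟩, ⟨x, hx⟩⟩ => by
        have h1 : (f.coprod (zmodHomOfTorsion x hx.1)).comp (AddMonoidHom.inl G (ZMod ℓ)) = f := by
          ext; simp
        have h2 : (f.coprod (zmodHomOfTorsion x hx.1)) (0, 1) = x := by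
          simp [zmodHomOfTorsion_one]
        apply Sigma.ext
        · exact Subtype.ext h1
        · simp only
          congr! 1
          rw [h1] }
  have : Fintype {f : G →+ H // Function.Injective f} := Fintype.ofFinite _
  rw [cardInj, Nat.card_congr e, Nat.card_sigma]
  rw [Finset.sum_congr rfl fun f _ => card_torsion_not_mem_range f.1 f.2, Finset.sum_const,
    Finset.card_univ, smul_eq_mul, cardInj, Nat.card_eq_fintype_card]

theorem cardInj_prod_pi {ℓ : ℕ} (hℓ : ℓ.Prime) [Finite G] [Finite H] (k : ℕ) :
    cardInj (G × (Fin k → ZMod ℓ)) H =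
      cardInj G H * ∏ i ∈ Finset.range k, (cardTorsion ℓ H - cardTorsion ℓ G * ℓ ^ i) := by
  have : NeZero ℓ := ⟨hℓ.ne_zero⟩
  induction k with
  | zero =>
    rw [Finset.prod_range_zero, mul_one]
    exact cardInj_congr AddEquiv.prodUnique (AddEquiv.refl H)
  | succ k ih =>
    have e : (G × (Fin (k + 1) → ZMod ℓ)) ≃+ (G × (Fin k → ZMod ℓ)) × ZMod ℓ :=
      ((AddEquiv.refl G).prodCongr
        ((Fin.consLinearEquiv ℕ fun _ : Fin (k + 1) => ZMod ℓ).symm.toAddEquiv.trans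
          AddEquiv.prodComm)).trans (AddEquiv.prodAssoc).symm
    rw [cardInj_congr e (AddEquiv.refl H), cardInj_prod_zmod hℓ, ih, Finset.prod_range_succ,
      cardTorsion_prod, cardTorsion_pi, mul_assoc]

theorem natCard_dual (K V : Type*) [Field K] [AddCommGroup V] [Module K V] [Module.Finite K V] :
    Nat.card (Module.Dual K V) = Nat.card V := by
  rw [Module.natCard_eq_pow_finrank (K := K) (V := Module.Dual K V), Subspace.dual_finrank_eq,
    ← Module.natCard_eq_pow_finrank]

theorem card_addMonoidHom_zmod_of_module {ℓ : ℕ} [Fact ℓ.Prime] (V : Type*)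
    [AddCommGroup V] [Finite V] [Module (ZMod ℓ) V] :
    Nat.card (V →+ ZMod ℓ) = Nat.card V :=
  (Nat.card_congr (AddMonoidHom.toZModLinearMapEquiv ℓ).toEquiv).trans (natCard_dual (ZMod ℓ) V)

theorem card_addMonoidHom_zmod {ℓ : ℕ} (hℓ : ℓ.Prime) [Finite G] :
    Nat.card (G →+ ZMod ℓ) = cardTorsion ℓ G := by
  have : Fact ℓ.Prime := ⟨hℓ⟩
  let S : AddSubgroup G := (nsmulAddMonoidHom (α := G) ℓ).range
  have e1 : (G →+ ZMod ℓ) ≃ (G ⧸ S →+ ZMod ℓ) :=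
    { toFun := fun f => QuotientAddGroup.lift S f (by
        rintro _ ⟨x, rfl⟩
        simp [AddMonoidHom.mem_ker])
      invFun := fun f => f.comp (QuotientAddGroup.mk' S)
      left_inv := fun f => by ext; simp
      right_inv := fun f => by ext; simp }
  have h1 : Nat.card (G →+ ZMod ℓ) = Nat.card (G ⧸ S) := by
    let _ : Module (ZMod ℓ) (G ⧸ S) := QuotientAddGroup.zmodModule fun x => ⟨x, rfl⟩
    rw [Nat.card_congr e1]
    exact card_addMonoidHom_zmod_of_module (G ⧸ S)
  have h2 := AddSubgroup.card_eq_card_quotient_mul_card_addSubgroup S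
  have h3 := AddSubgroup.card_eq_card_quotient_mul_card_addSubgroup
    (nsmulAddMonoidHom (α := G) ℓ).ker
  rw [Nat.card_congr (QuotientAddGroup.quotientKerEquivRange _).toEquiv] at h3
  have h4 : Nat.card (nsmulAddMonoidHom (α := G) ℓ).ker = cardTorsion ℓ G :=
    Nat.card_congr (Equiv.subtypeEquivRight fun a => by simp [AddMonoidHom.mem_ker])
  rw [h1, ← h4]
  have hS : 0 < Nat.card S := Nat.card_pos
  apply Nat.eq_of_mul_eq_mul_right hS
  rw [← h2, h3, mul_comm]

/-- If the `ℓ`-torsion of `G` consists of multiples of `ℓ`, a homomorphism from `G` to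
`G × (ZMod ℓ) ^ n` is injective exactly when its first component is. -/
theorem cardInj_self_prod_pi {ℓ : ℕ} (hℓ : ℓ.Prime) [Finite G]
    (hG : ∀ a : G, ∃ n : ℕ, (ℓ ^ n) • a = 0) (hdiv : ∀ a : G, ℓ • a = 0 → ∃ b, a = ℓ • b)
    (n : ℕ) :
    cardInj G (G × (Fin n → ZMod ℓ)) = cardInj G G * cardTorsion ℓ G ^ n := by
  have hinj (g : G →+ G) (h : Fin n → (G →+ ZMod ℓ))
      (hgh : Function.Injective (g.prod (AddMonoidHom.pi h))) : Function.Injective g := by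
    refine injective_of_injective_on_torsion hG g fun a ha hga => ?_
    refine (injective_iff_map_eq_zero _).1 hgh a (Prod.ext hga ?_)
    obtain ⟨b, rfl⟩ := hdiv a ha
    ext i
    simp
  have e : {f : G →+ G × (Fin n → ZMod ℓ) // Function.Injective f} ≃
      {f : G →+ G // Function.Injective f} × (Fin n → (G →+ ZMod ℓ)) :=
    { toFun := fun f => ⟨⟨(AddMonoidHom.fst _ _).comp f.1,
          hinj _ (fun i => (Pi.evalAddMonoidHom _ i).comp ((AddMonoidHom.snd _ _).comp f.1)) f.2⟩,
        fun i => (Pi.evalAddMonoidHom _ i).comp ((AddMonoidHom.snd _ _).comp f.1)⟩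
      invFun := fun p => ⟨p.1.1.prod (AddMonoidHom.pi p.2),
        fun a b hab => p.1.2 (congrArg Prod.fst hab)⟩
      left_inv := fun f => rfl
      right_inv := fun p => rfl }
  rw [cardInj, Nat.card_congr e, Nat.card_prod, Nat.card_fun, card_addMonoidHom_zmod hℓ]
  simp [cardInj]

end Injections

/-- A finite abelian `ℓ`-group is the product of an elementary abelian group and a group whose
`ℓ`-torsion consists of multiples of `ℓ`. -/
theorem exists_addEquiv_prod_pi_zmod {ℓ : ℕ} (hℓ : ℓ.Prime) (A : Type*) [AddCommGroup A] [Finite A]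
    (hA : ∀ a : A, ∃ n : ℕ, (ℓ ^ n) • a = 0) :
    ∃ (B : Type) (_ : AddCommGroup B) (t : ℕ), Finite B ∧ (∀ b : B, ∃ n : ℕ, (ℓ ^ n) • b = 0) ∧
      (∀ b : B, ℓ • b = 0 → ∃ c, b = ℓ • c) ∧ Nonempty (A ≃+ B × (Fin t → ZMod ℓ)) := by
  classical
  obtain ⟨ι, _, p, hp, e, ⟨φ⟩⟩ := AddCommGroup.equiv_directSum_zmod_of_finite A
  let ψ : A ≃+ (∀ i, ZMod (p i ^ e i)) := φ.trans (DirectSum.addEquivProd _)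
  have hpi : ∀ i, e i ≠ 0 → p i = ℓ := by
    intro i hi
    obtain ⟨n, hn⟩ := hA (ψ.symm (Pi.single i 1))
    rw [← map_nsmul, EmbeddingLike.map_eq_zero_iff] at hn
    have h1 := congrFun hn i
    rw [Pi.smul_apply, Pi.single_eq_same, Pi.zero_apply, nsmul_one, ZMod.natCast_eq_zero_iff] at h1
    exact (Nat.prime_dvd_prime_iff_eq (hp i) hℓ).1
      ((hp i).dvd_of_dvd_pow ((dvd_pow_self _ hi).trans h1))
  have (i : ι) : NeZero (p i ^ e i) := ⟨pow_ne_zero _ (hp i).ne_zero⟩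
  let B := ∀ i : {i // ¬ e i = 1}, ZMod (p i ^ e i)
  let C := ∀ i : {i // e i = 1}, ZMod (p i ^ e i)
  let t := Fintype.card {i // e i = 1}
  have eC : C ≃+ (Fin t → ZMod ℓ) :=
    (AddEquiv.piCongrRight fun i : {i // e i = 1} =>
      (ZMod.ringEquivCongr (show p i ^ e i = ℓ by
        rw [hpi i (by rw [i.2]; exact one_ne_zero), i.2, pow_one])).toAddEquiv).trans
      (LinearEquiv.funCongrLeft ℕ (ZMod ℓ) (Fintype.equivFin {i // e i = 1}).symm).toAddEquiv
  let eBC : (∀ i, ZMod (p i ^ e i)) ≃+ B × C :=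
    (RingEquiv.piEquivPiSubtypeProd (fun i => e i = 1)
      (fun i => ZMod (p i ^ e i))).toAddEquiv.trans AddEquiv.prodComm
  refine ⟨B, inferInstance, t, inferInstance, fun b => ?_, fun b hb => ?_,
    ⟨ψ.trans (eBC.trans ((AddEquiv.refl B).prodCongr eC))⟩⟩
  · obtain ⟨n, hn⟩ := hA ((ψ.trans eBC).symm (b, 0))
    rw [← map_nsmul, EmbeddingLike.map_eq_zero_iff] at hn
    exact ⟨n, congrArg Prod.fst hn⟩
  · have : ∀ i : {i // ¬ e i = 1}, ∃ c : ZMod (p i ^ e i), b i = ℓ • c := by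
      rintro ⟨i, hi⟩
      have hbi : ℓ • b ⟨i, hi⟩ = 0 := congrFun hb ⟨i, hi⟩
      obtain ⟨n, hn⟩ : ∃ n : ℕ, (n : ZMod (p i ^ e i)) = b ⟨i, hi⟩ := ⟨_, ZMod.natCast_zmod_val _⟩
      rw [← hn] at hbi ⊢
      by_cases h0 : e i = 0
      · have : Subsingleton (ZMod (p i ^ e i)) := by
          rw [h0, pow_zero]
          infer_instance
        exact ⟨0, Subsingleton.elim _ _⟩
      · rw [nsmul_eq_mul, ← Nat.cast_mul, ZMod.natCast_eq_zero_iff, hpi i h0,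
          show e i = (e i - 2) + 1 + 1 by omega, pow_succ', Nat.mul_dvd_mul_iff_left hℓ.pos,
          pow_succ'] at hbi
        obtain ⟨c, rfl⟩ := dvd_of_mul_right_dvd hbi
        exact ⟨c, by rw [nsmul_eq_mul, Nat.cast_mul]⟩
    choose c hc using this
    exact ⟨c, funext hc⟩

theorem lPoch_ne_zero {ℓ : ℕ} (hℓ : 1 < ℓ) (m : ℕ) : lPoch ℓ m ≠ 0 := by
  refine Finset.prod_ne_zero_iff.2 fun j _ => ?_
  have h : ((ℓ : ℝ))⁻¹ < 1 := inv_lt_one_of_one_lt₀ (by exact_mod_cast hℓ)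
  have := pow_lt_one₀ (by positivity) h (Nat.succ_ne_zero j)
  exact (sub_pos.2 this).ne'

theorem prod_pow_sub_pow {ℓ : ℕ} (hℓ : 1 < ℓ) (s k d : ℕ) :
    ((∏ i ∈ Finset.range k, (ℓ ^ (s + (d + k)) - ℓ ^ s * ℓ ^ i) : ℕ) : ℝ) * lPoch ℓ d =
      (ℓ : ℝ) ^ ((s + (d + k)) * k) * lPoch ℓ (d + k) := by
  have hℓ0 : (ℓ : ℝ) ≠ 0 := by positivity
  have h1 : ((∏ i ∈ Finset.range k, (ℓ ^ (s + (d + k)) - ℓ ^ s * ℓ ^ i) : ℕ) : ℝ) =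
      ∏ i ∈ Finset.range k, ((ℓ : ℝ) ^ (s + (d + k)) * (1 - (ℓ : ℝ)⁻¹ ^ (d + (k - 1 - i) + 1))) := by
    rw [Nat.cast_prod]
    refine Finset.prod_congr rfl fun i hi => ?_
    have hi := Finset.mem_range.1 hi
    rw [← pow_add, Nat.cast_sub (Nat.pow_le_pow_right (by omega) (by omega)), mul_sub, mul_one,
      show s + (d + k) = (s + i) + (d + (k - 1 - i) + 1) by omega, pow_add (ℓ : ℝ) (s + i), mul_assoc,
      ← mul_pow, mul_inv_cancel₀ hℓ0, one_pow]
    push_cast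
    rw [← pow_add]
    ring
  rw [h1, Finset.prod_mul_distrib, Finset.prod_const, Finset.card_range, ← pow_mul,
    Finset.prod_range_reflect (fun i => 1 - (ℓ : ℝ)⁻¹ ^ (d + i + 1)) k, mul_assoc, lPoch, lPoch,
    Finset.prod_range_add, mul_comm (∏ i ∈ Finset.range d, _)]

/-- For a finite abelian `ℓ`-group `A` of `ℓ`-rank `r` and `ℓ²`-rank `s`, with
`A_{⊕i} = A ⊕ (Z/ℓ)^i`, and `0 ≤ k ≤ m`, the number of subgroups of `A_{⊕m}`
isomorphic to `A_{⊕k}` is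
`ℓ^{(r+k)(m−k)} (ℓ^{-1})_{r−s+m} / ((ℓ^{-1})_{r−s+k} (ℓ^{-1})_{m−k})`. -/
theorem card_subgroups_iso (ℓ : ℕ) (hℓ : ℓ.Prime)
    (A : Type*) [AddCommGroup A] [Finite A]
    (hℓgrp : ∀ a : A, ∃ n : ℕ, (ℓ ^ n) • a = 0)
    (r s : ℕ)
    (hr : Nat.card {a : A // ℓ • a = 0} = ℓ ^ r)
    (hs : Nat.card {a : A // (∃ b : A, a = ℓ • b) ∧ ℓ • a = 0} = ℓ ^ s)
    (k m : ℕ) (hkm : k ≤ m) :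
    (Nat.card {H : AddSubgroup (A × (Fin m → ZMod ℓ)) //
        Nonempty (H ≃+ (A × (Fin k → ZMod ℓ)))} : ℝ)
      = (ℓ : ℝ) ^ ((r + k) * (m - k)) * lPoch ℓ (r - s + m) /
        (lPoch ℓ (r - s + k) * lPoch ℓ (m - k)) := by
  obtain ⟨B, _, t, _, hB, hdiv, ⟨φ⟩⟩ := exists_addEquiv_prod_pi_zmod hℓ A hℓgrp
  have : NeZero ℓ := ⟨hℓ.ne_zero⟩
  have hBs : cardTorsion ℓ B = ℓ ^ s := by
    rw [← hs]
    refine Nat.card_congr (Equiv.ofBijective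
      (fun b => ⟨φ.symm (b.1, 0), ?_, ?_⟩) ⟨?_, ?_⟩)
    · obtain ⟨c, hc⟩ := hdiv b.1 b.2
      exact ⟨φ.symm (c, 0), by rw [← map_nsmul, hc]; simp⟩
    · rw [← map_nsmul, Prod.smul_mk, b.2, smul_zero]
      exact map_zero _
    · intro b c h
      exact Subtype.ext (congrArg Prod.fst (φ.symm.injective (congrArg Subtype.val h)))
    · rintro ⟨a, ⟨b, rfl⟩, ha⟩
      have hb0 : ℓ • (φ b).2 = 0 := by
        ext i
        simp
      refine ⟨⟨ℓ • (φ b).1, ?_⟩, Subtype.ext (φ.injective ?_)⟩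
      · simpa using congrArg (fun x => (φ x).1) ha
      · exact (AddEquiv.apply_symm_apply _ _).trans
          ((Prod.ext rfl hb0.symm : (ℓ • (φ b).1, 0) = ℓ • φ b).trans (map_nsmul φ ℓ b).symm)
  have hrst : r = s + t := by
    apply Nat.pow_right_injective hℓ.two_le
    change ℓ ^ r = ℓ ^ (s + t)
    rw [← hr, pow_add, ← hBs, ← cardTorsion_pi ℓ t, ← cardTorsion_prod]
    exact cardTorsion_congr ℓ φ
  have eA (n : ℕ) : (A × (Fin n → ZMod ℓ)) ≃+ (B × (Fin (t + n) → ZMod ℓ)) :=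
    (φ.prodCongr (AddEquiv.refl _)).trans (AddEquiv.prodAssoc.trans
      ((AddEquiv.refl B).prodCongr
        ((LinearEquiv.sumArrowLequivProdArrow (Fin t) (Fin n) ℕ (ZMod ℓ)).symm.trans
          (LinearEquiv.funCongrLeft ℕ (ZMod ℓ) finSumFinEquiv.symm)).toAddEquiv))
  have hinj (n : ℕ) : cardInj (A × (Fin k → ZMod ℓ)) (A × (Fin n → ZMod ℓ)) =
      cardInj B B * ℓ ^ (s * (t + n)) *
        ∏ i ∈ Finset.range (t + k), (ℓ ^ (s + (t + n)) - ℓ ^ s * ℓ ^ i) := by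
    rw [cardInj_congr (eA k) (eA n), cardInj_prod_pi hℓ, cardInj_self_prod_pi hℓ hB hdiv,
      cardTorsion_prod, cardTorsion_pi, hBs, ← pow_mul, ← pow_add]
  have hsub := cardInj_eq_card_subgroups_mul (G := A × (Fin k → ZMod ℓ))
    (H := A × (Fin m → ZMod ℓ))
  obtain ⟨d, rfl⟩ := Nat.exists_eq_add_of_le hkm
  rw [hinj, hinj] at hsub
  have hprod := prod_pow_sub_pow hℓ.one_lt s (t + k) d
  have hprod0 := prod_pow_sub_pow hℓ.one_lt s (t + k) 0
  rw [zero_add, show lPoch ℓ 0 = 1 by simp [lPoch], mul_one] at hprod0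
  rw [show d + (t + k) = t + (k + d) by omega] at hprod
  replace hsub := congrArg (Nat.cast : ℕ → ℝ) hsub
  rw [Nat.cast_mul (_ * _), Nat.cast_mul (Nat.card _), Nat.cast_mul (_ * _), hprod0] at hsub
  have hBB : (cardInj B B : ℝ) ≠ 0 := by exact_mod_cast (cardInj_self_pos B).ne'
  have hℓ0 : (ℓ : ℝ) ≠ 0 := by exact_mod_cast hℓ.ne_zero
  have hk := lPoch_ne_zero hℓ.one_lt (t + k)
  have hd := lPoch_ne_zero hℓ.one_lt d
  rw [show r - s = t by omega, hrst, show k + d - k = d by omega,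
    eq_div_iff (mul_ne_zero hk hd)]
  have hc : (cardInj B B : ℝ) * (ℓ : ℝ) ^ (s * (t + k) + (s + (t + k)) * (t + k)) ≠ 0 := by
    positivity
  apply mul_left_cancel₀ hc
  push_cast at hsub hprod
  calc _ = (Nat.card {H : AddSubgroup (A × (Fin (k + d) → ZMod ℓ)) //
          Nonempty (H ≃+ (A × (Fin k → ZMod ℓ)))} : ℝ) *
        ((cardInj B B : ℝ) * (ℓ : ℝ) ^ (s * (t + k)) *
          ((ℓ : ℝ) ^ ((s + (t + k)) * (t + k)) * lPoch ℓ (t + k))) * lPoch ℓ d := by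
        rw [pow_add]
        ring
    _ = cardInj B B * (ℓ : ℝ) ^ (s * (t + (k + d))) *
        ((ℓ : ℝ) ^ ((s + (t + (k + d))) * (t + k)) * lPoch ℓ (t + (k + d))) := by
        rw [← hsub, mul_assoc, ← hprod]
    _ = _ := by ring
end
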